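/- arXiv:1101.5867 — 2 statements merged into one kernel-verified Lean document; each statement's English description precedes it below -/
import Mathlib

section
/- The cross product h* = g × k is an eigenvector of the transpose matrix Sᵀ with eigenvalue σ: Sᵀ·(g × k) = σ·(g × k). -/
open Matrix

noncomputable def cbrt2 : ℝ := (2 : ℝ) ^ ((1 : ℝ) / 3)
noncomputable def cbrt4 : ℝ := (2 : ℝ) ^ ((2 : ℝ) / 3)
noncomputable def σ : ℝ := cbrt2 - 1

def S : Matrix (Fin 3) (Fin 3) ℝ := !![0, 0, 1; 1, 0, -3; 0, 1, -3]

noncomputable def g : Fin 3 → ℝ :=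
  (1 / 12 : ℝ) • ![-cbrt2, 4 + 2 * cbrt2 - cbrt4, cbrt2 - cbrt4]

noncomputable def k : Fin 3 → ℝ :=
  (Real.sqrt 3 / 12) • ![cbrt2, -2 * cbrt2 - cbrt4, -cbrt2 - cbrt4]

lemma cbrt2_pow_three : cbrt2 ^ 3 = 2 := by
  rw [cbrt2, ← Real.rpow_natCast, ← Real.rpow_mul (by norm_num)]
  norm_num

lemma cbrt4_eq_cbrt2_sq : cbrt4 = cbrt2 ^ 2 := by
  rw [cbrt4, cbrt2, ← Real.rpow_natCast, ← Real.rpow_mul (by norm_num)]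
  norm_num

theorem hstar_is_eigenvector_of_transpose :
    Sᵀ.mulVec (crossProduct g k) = σ • (crossProduct g k) := by
  have h := cbrt2_pow_three
  ext i
  fin_cases i <;>
    simp [S, g, k, σ, cross_apply, mulVec, dotProduct, Fin.sum_univ_three, cbrt4_eq_cbrt2_sq] <;>
    grind
end

section
/- For every integer j, s*_j = −2·√3·2^(1/3)·(σ^j·h* + ρ^(j/2)·(g*·cos(jθ − π/3) − k*·sin(jθ − π/3))) as vectors in ℝ³, where h* = g × k, g* = h × k, k* = h × g. -/
open Matrix

noncomputable def ρ : ℝ := 1 + cbrt2 + cbrt4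

noncomputable def h : Fin 3 → ℝ :=
  (1 / 6 : ℝ) • ![cbrt2, 2 - 2 * cbrt2 + cbrt4, -cbrt2 + cbrt4]

noncomputable def θ : ℝ := Real.pi - Real.arctan (Real.sqrt 3 * cbrt2 / (2 + cbrt2))

noncomputable def hstar : Fin 3 → ℝ := crossProduct g k
noncomputable def gstar : Fin 3 → ℝ := crossProduct h k
noncomputable def kstar : Fin 3 → ℝ := crossProduct h g

lemma cbrt2_pos : 0 < cbrt2 := by unfold cbrt2; positivity

lemma ρ_pos : 0 < ρ := by
  have := cbrt2_pos
  rw [ρ, cbrt4_eq_cbrt2_sq]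
  positivity

lemma σ_ne_zero : σ ≠ 0 := by
  intro hσ
  have hc : cbrt2 = 1 := by rw [σ] at hσ; linarith
  have := cbrt2_pow_three
  norm_num [hc] at this

lemma sqrt_one_add_sq_tan_arg :
    Real.sqrt (1 + (Real.sqrt 3 * cbrt2 / (2 + cbrt2)) ^ 2) =
      2 * Real.sqrt ρ / (2 + cbrt2) := by
  have hc := cbrt2_pos
  have hs : Real.sqrt 3 ^ 2 = 3 := Real.sq_sqrt (by norm_num)
  rw [Real.sqrt_eq_iff_eq_sq (by positivity) (by positivity), div_pow, div_pow, mul_pow, mul_pow,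
    hs, Real.sq_sqrt ρ_pos.le, ρ, cbrt4_eq_cbrt2_sq]
  field_simp
  ring

lemma sqrt_ρ_mul_cos_θ : Real.sqrt ρ * Real.cos θ = -(2 + cbrt2) / 2 := by
  have hc := cbrt2_pos
  have hr : 0 < Real.sqrt ρ := Real.sqrt_pos.2 ρ_pos
  rw [θ, Real.cos_pi_sub, Real.cos_arctan, sqrt_one_add_sq_tan_arg]
  field_simp

lemma sqrt_ρ_mul_sin_θ : Real.sqrt ρ * Real.sin θ = Real.sqrt 3 * cbrt2 / 2 := by
  have hc := cbrt2_pos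
  have hr : 0 < Real.sqrt ρ := Real.sqrt_pos.2 ρ_pos
  rw [θ, Real.sin_pi_sub, Real.sin_arctan, sqrt_one_add_sq_tan_arg]
  field_simp

lemma transpose_S_mulVec (v : Fin 3 → ℝ) :
    Sᵀ *ᵥ v = ![v 1, v 2, v 0 - 3 * v 1 - 3 * v 2] := by
  ext i
  fin_cases i <;> simp [S, Matrix.mulVec, dotProduct, Fin.sum_univ_three]
  ring

lemma transpose_S_mulVec_injective : Function.Injective (fun v => Sᵀ *ᵥ v) := by
  intro v w hvw
  simp only [transpose_S_mulVec] at hvw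
  have h0 := congrFun hvw 0
  have h1 := congrFun hvw 1
  have h2 := congrFun hvw 2
  simp at h0 h1 h2
  ext i
  fin_cases i <;> simp <;> linarith

lemma transpose_S_mulVec_hstar : Sᵀ *ᵥ hstar = σ • hstar := by
  have hc := cbrt2_pow_three
  rw [transpose_S_mulVec]
  ext i
  fin_cases i <;>
    simp [hstar, g, k, σ, cross_apply, cbrt4_eq_cbrt2_sq] <;> grind

lemma transpose_S_mulVec_gstar :
    Sᵀ *ᵥ gstar = (-(2 + cbrt2) / 2) • gstar - (Real.sqrt 3 * cbrt2 / 2) • kstar := by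
  have hc := cbrt2_pow_three
  rw [transpose_S_mulVec]
  ext i
  fin_cases i <;>
    simp [gstar, kstar, h, g, k, cross_apply, cbrt4_eq_cbrt2_sq] <;> grind

lemma transpose_S_mulVec_kstar :
    Sᵀ *ᵥ kstar = (-(2 + cbrt2) / 2) • kstar + (Real.sqrt 3 * cbrt2 / 2) • gstar := by
  have hc := cbrt2_pow_three
  have hs : Real.sqrt 3 ^ 2 = 3 := Real.sq_sqrt (by norm_num)
  rw [transpose_S_mulVec]
  ext i
  fin_cases i <;>
    simp [gstar, kstar, h, g, k, cross_apply, cbrt4_eq_cbrt2_sq] <;> grind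

/-- The claimed closed form of the orbit of the first standard basis vector under `Sᵀ`. -/
noncomputable def spectralForm (j : ℤ) : Fin 3 → ℝ :=
  (-2 * Real.sqrt 3 * cbrt2) •
    (σ ^ j • hstar +
      ρ ^ ((j : ℝ) / 2) •
        (Real.cos (j * θ - Real.pi / 3) • gstar -
          Real.sin (j * θ - Real.pi / 3) • kstar))

lemma spectralForm_zero : spectralForm 0 = ![1, 0, 0] := by
  have hc := cbrt2_pow_three
  have hs : Real.sqrt 3 ^ 2 = 3 := Real.sq_sqrt (by norm_num)
  ext i
  fin_cases i <;>
    simp [spectralForm, hstar, gstar, kstar, h, g, k, cross_apply, cbrt4_eq_cbrt2_sq] <;> grind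

lemma spectralForm_add_one (j : ℤ) : spectralForm (j + 1) = Sᵀ *ᵥ spectralForm j := by
  have hρ : ρ ^ (((j + 1 : ℤ) : ℝ) / 2) = ρ ^ ((j : ℝ) / 2) * Real.sqrt ρ := by
    rw [Real.sqrt_eq_rpow, ← Real.rpow_add ρ_pos]
    push_cast
    ring_nf
  have hθ : ((j + 1 : ℤ) : ℝ) * θ - Real.pi / 3 = (j * θ - Real.pi / 3) + θ := by
    push_cast
    ring
  simp only [spectralForm, hρ, hθ, zpow_add_one₀ σ_ne_zero, Matrix.mulVec_smul, Matrix.mulVec_add,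
    Matrix.mulVec_sub, transpose_S_mulVec_hstar, transpose_S_mulVec_gstar,
    transpose_S_mulVec_kstar, ← sqrt_ρ_mul_cos_θ, ← sqrt_ρ_mul_sin_θ, Real.cos_add, Real.sin_add]
  module

theorem sstar_j_spectral_expansion
    (sstar : ℤ → (Fin 3 → ℝ))
    (hsstar0 : sstar 0 = ![1, 0, 0])
    (hsstar : ∀ j : ℤ, sstar (j + 1) = Sᵀ.mulVec (sstar j)) :
    ∀ j : ℤ,
      sstar j = (-2 * Real.sqrt 3 * cbrt2) •
        (σ ^ j • hstar +
          ρ ^ ((j : ℝ) / 2) •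
            (Real.cos (j * θ - Real.pi / 3) • gstar -
              Real.sin (j * θ - Real.pi / 3) • kstar)) := by
  intro j
  change sstar j = spectralForm j
  induction j using Int.induction_on with
  | zero => rw [hsstar0, spectralForm_zero]
  | succ n ih => rw [hsstar, ih, spectralForm_add_one]
  | pred n ih =>
    apply transpose_S_mulVec_injective
    change Sᵀ *ᵥ _ = Sᵀ *ᵥ _
    rw [← hsstar, ← spectralForm_add_one, sub_add_cancel, ih]
end
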